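/- arXiv:alg-geom/9610004 — 2 statements merged into one kernel-verified Lean document; each statement's English description precedes it below -/
import Mathlib

section
/- Assume ρ acts freely outside the origin. For λ ∈ ℂⁿ define the n-tuple β(λ) of endomorphisms of ℂ^Γ by β(λ)_k e_γ := (ρ(γ)λ)_k · e_γ. Then each β(λ) is Γ-equivariant, commuting, and satisfies the zero-moment condition, and the assignment λ ↦ β(λ) induces a bijection from the orbit space ℂⁿ/Γ onto the set of equivalence classes of Γ-equivariant, commuting, zero-moment n-tuples under simultaneous conjugation by unitary operators on ℂ^Γ that commute with φ(γ) for all γ ∈ Γ. -/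
open Matrix

variable {Γ : Type} [Group Γ] [Fintype Γ] [DecidableEq Γ]

/-- The left regular representation of `Γ` on `ℂ^Γ`, as a matrix: `φ(γ) e_δ = e_{γδ}`. -/
def phi (γ : Γ) : Matrix Γ Γ ℂ :=
  fun a b => if a = γ * b then 1 else 0

/-- `Γ`-equivariance of an `n`-tuple of endomorphisms of `ℂ^Γ`:
`φ(γ)⁻¹ αₖ φ(γ) = ∑ l, ρ(γ)_{kl} α_l` for all `γ` and `k`. -/
def Equivariant (n : ℕ) (ρ : Γ →* Matrix.unitaryGroup (Fin n) ℂ)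
    (α : Fin n → Matrix Γ Γ ℂ) : Prop :=
  ∀ (γ : Γ) (k : Fin n),
    phi γ⁻¹ * α k * phi γ = ∑ l, ((ρ γ : Matrix (Fin n) (Fin n) ℂ) k l) • α l

/-- The components pairwise commute. -/
def CommutingTuple (n : ℕ) (α : Fin n → Matrix Γ Γ ℂ) : Prop :=
  ∀ i j, α i * α j = α j * α i

/-- The zero-moment condition `∑ i, (αᵢ* αᵢ − αᵢ αᵢ*) = 0`. -/
def ZeroMoment (n : ℕ) (α : Fin n → Matrix Γ Γ ℂ) : Prop :=
  ∑ i, ((α i)ᴴ * α i - α i * (α i)ᴴ) = 0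

/-- Equivariant, commuting, zero-moment `n`-tuples. -/
def IsGood (n : ℕ) (ρ : Γ →* Matrix.unitaryGroup (Fin n) ℂ)
    (α : Fin n → Matrix Γ Γ ℂ) : Prop :=
  Equivariant n ρ α ∧ CommutingTuple n α ∧ ZeroMoment n α

/-- The `n`-tuple `β(λ)` of diagonal endomorphisms of `ℂ^Γ`:
`β(λ)_k e_γ = (ρ(γ)λ)_k ⬝ e_γ`. -/
noncomputable def betaTuple (n : ℕ) (ρ : Γ →* Matrix.unitaryGroup (Fin n) ℂ) (lam : Fin n → ℂ) :
    Fin n → Matrix Γ Γ ℂ :=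
  fun k => Matrix.diagonal fun γ : Γ => ((ρ γ : Matrix (Fin n) (Fin n) ℂ).mulVec lam) k

/-- Two points of `ℂⁿ` are related if they lie in the same `Γ`-orbit. -/
def gammaRel (n : ℕ) (ρ : Γ →* Matrix.unitaryGroup (Fin n) ℂ)
    (lam mu : Fin n → ℂ) : Prop :=
  ∃ γ : Γ, mu = (ρ γ : Matrix (Fin n) (Fin n) ℂ).mulVec lam

/-- Two good `n`-tuples are related if they differ by simultaneous conjugation by a unitary
operator on `ℂ^Γ` commuting with `φ(γ)` for all `γ`. -/
def conjRel (n : ℕ) (ρ : Γ →* Matrix.unitaryGroup (Fin n) ℂ)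
    (a b : {α : Fin n → Matrix Γ Γ ℂ // IsGood n ρ α}) : Prop :=
  ∃ T : Matrix Γ Γ ℂ, T ∈ Matrix.unitaryGroup Γ ℂ ∧
    (∀ γ : Γ, T * phi γ = phi γ * T) ∧ ∀ i, b.1 i = T * a.1 i * Tᴴ

/-- `ρ` acts freely outside the origin: `ρ(γ)v = v` for some `v ≠ 0` implies `γ = 1`. -/
def FreeOutside (n : ℕ) (ρ : Γ →* Matrix.unitaryGroup (Fin n) ℂ) : Prop :=
  ∀ (γ : Γ) (v : Fin n → ℂ), v ≠ 0 →
    (ρ γ : Matrix (Fin n) (Fin n) ℂ).mulVec v = v → γ = 1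

open scoped ComplexOrder

lemma aux_phi_mul (g : Γ) (A : Matrix Γ Γ ℂ) (a b : Γ) : (phi g * A) a b = A (g⁻¹ * a) b := by
  rw [Matrix.mul_apply, Finset.sum_eq_single (g⁻¹ * a)]
  · simp [phi]
  · intro c _ hc
    have : a ≠ g * c := by
      rintro rfl
      simp at hc
    simp [phi, this]
  · simp

lemma aux_mul_phi (g : Γ) (A : Matrix Γ Γ ℂ) (a b : Γ) : (A * phi g) a b = A a (g * b) := by
  rw [Matrix.mul_apply, Finset.sum_eq_single (g * b)]
  · simp [phi]
  · intro c _ hc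
    simp [phi, hc]
  · simp

lemma aux_phi_mulVec (g : Γ) (v : Γ → ℂ) (a : Γ) : (phi g *ᵥ v) a = v (g⁻¹ * a) := by
  rw [Matrix.mulVec, dotProduct, Finset.sum_eq_single (g⁻¹ * a)]
  · simp [phi]
  · intro c _ hc
    have : a ≠ g * c := by
      rintro rfl
      simp at hc
    simp [phi, this]
  · simp

lemma aux_phi_cancel (g : Γ) : phi g * phi g⁻¹ = (1 : Matrix Γ Γ ℂ) := by
  ext a b
  rw [aux_phi_mul, phi, Matrix.one_apply]
  simp

lemma aux_beta_good (n : ℕ) (ρ : Γ →* Matrix.unitaryGroup (Fin n) ℂ) (lam : Fin n → ℂ) :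
    IsGood n ρ (betaTuple n ρ lam) := by
  refine ⟨?_, ?_, ?_⟩
  · intro g k
    ext a b
    rw [aux_mul_phi, aux_phi_mul, Matrix.sum_apply]
    simp only [betaTuple, Matrix.smul_apply, Matrix.diagonal_apply, inv_inv, mul_right_inj]
    by_cases h : a = b
    · subst h
      simp only [if_true, map_mul, Submonoid.coe_mul, smul_eq_mul]
      rw [← Matrix.mulVec_mulVec]
      rfl
    · simp [h]
  · intro i j
    simp only [betaTuple, Matrix.diagonal_mul_diagonal, mul_comm]
  · refine Finset.sum_eq_zero fun i _ => ?_
    simp only [betaTuple, Matrix.diagonal_conjTranspose, Matrix.diagonal_mul_diagonal]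
    rw [sub_eq_zero]
    congr 1
    ext
    exact mul_comm _ _

/-- joint eigenvalues -/
def auxJ (n : ℕ) (α : Fin n → Matrix Γ Γ ℂ) : Set (Fin n → ℂ) :=
  {μ | ∃ v : Γ → ℂ, v ≠ 0 ∧ ∀ i, α i *ᵥ v = μ i • v}

lemma auxJ_sub (n : ℕ) (a b : Fin n → Matrix Γ Γ ℂ) (T : Matrix Γ Γ ℂ)
    (hT : Tᴴ * T = 1) (h : ∀ i, b i = T * a i * Tᴴ) : auxJ n a ⊆ auxJ n b := by
  rintro μ ⟨v, hv, hev⟩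
  refine ⟨T *ᵥ v, ?_, fun i => ?_⟩
  · intro h0
    apply hv
    have := congrArg (fun w => Tᴴ *ᵥ w) h0
    simpa [Matrix.mulVec_mulVec, hT] using this
  · rw [h, Matrix.mulVec_mulVec, Matrix.mul_assoc, hT, Matrix.mul_one, ← Matrix.mulVec_mulVec,
      hev, Matrix.mulVec_smul]

lemma auxJ_conj (n : ℕ) (ρ : Γ →* Matrix.unitaryGroup (Fin n) ℂ)
    (a b : {α : Fin n → Matrix Γ Γ ℂ // IsGood n ρ α}) (h : conjRel n ρ a b) :
    auxJ n a.1 = auxJ n b.1 := by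
  obtain ⟨T, hT, -, h⟩ := h
  have h1 : Tᴴ * T = 1 := (Matrix.mem_unitaryGroup_iff').1 hT
  have h2 : T * Tᴴ = 1 := (Matrix.mem_unitaryGroup_iff).1 hT
  apply Set.Subset.antisymm
  · exact auxJ_sub n _ _ T h1 h
  · refine auxJ_sub n _ _ Tᴴ (by simpa using h2) fun i => ?_
    rw [h, Matrix.conjTranspose_conjTranspose]
    calc a.1 i = (Tᴴ * T) * a.1 i * (Tᴴ * T) := by simp [h1]
      _ = _ := by simp only [Matrix.mul_assoc]

lemma auxJ_beta (n : ℕ) (ρ : Γ →* Matrix.unitaryGroup (Fin n) ℂ) (lam mu : Fin n → ℂ) :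
    mu ∈ auxJ n (betaTuple n ρ lam) ↔ gammaRel n ρ lam mu := by
  constructor
  · rintro ⟨v, hv, h⟩
    obtain ⟨g, hg⟩ := Function.ne_iff.1 hv
    refine ⟨g, ?_⟩
    ext i
    have := congrFun (h i) g
    simp only [betaTuple, Matrix.mulVec_diagonal, Pi.smul_apply, smul_eq_mul] at this
    exact (mul_right_cancel₀ hg this).symm
  · rintro ⟨g, rfl⟩
    refine ⟨Pi.single g 1, by simp, fun i => ?_⟩
    ext a
    simp only [betaTuple, Matrix.mulVec_diagonal, Pi.smul_apply, smul_eq_mul]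
    by_cases h : a = g
    · subst h; rfl
    · simp [h]

lemma aux_rho_inv (n : ℕ) (ρ : Γ →* Matrix.unitaryGroup (Fin n) ℂ) (g : Γ) (v : Fin n → ℂ) :
    (ρ g⁻¹ : Matrix (Fin n) (Fin n) ℂ) *ᵥ ((ρ g : Matrix (Fin n) (Fin n) ℂ) *ᵥ v) = v := by
  rw [Matrix.mulVec_mulVec, ← Submonoid.coe_mul, ← map_mul]
  simp

lemma aux_welldef (n : ℕ) (ρ : Γ →* Matrix.unitaryGroup (Fin n) ℂ) (lam mu : Fin n → ℂ)
    (h : gammaRel n ρ lam mu) :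
    conjRel n ρ ⟨betaTuple n ρ lam, aux_beta_good n ρ lam⟩
      ⟨betaTuple n ρ mu, aux_beta_good n ρ mu⟩ := by
  obtain ⟨g, rfl⟩ := h
  let T : Matrix Γ Γ ℂ := fun a b => if a * g = b then 1 else 0
  have hTm : ∀ (A : Matrix Γ Γ ℂ) a b, (T * A) a b = A (a * g) b := by
    intro A a b
    rw [Matrix.mul_apply, Finset.sum_eq_single (a * g)]
    · simp [T]
    · intro c _ hc
      simp [T, hc.symm]
    · simp
  have hTT : ∀ (A : Matrix Γ Γ ℂ) a b, (A * Tᴴ) a b = A a (b * g) := by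
    intro A a b
    rw [Matrix.mul_apply, Finset.sum_eq_single (b * g)]
    · rw [Matrix.conjTranspose_apply]
      simp [T]
    · intro c _ hc
      rw [Matrix.conjTranspose_apply]
      simp [T, hc.symm]
    · simp
  refine ⟨T, ?_, ?_, ?_⟩
  · rw [Matrix.mem_unitaryGroup_iff]
    change T * Tᴴ = 1
    ext a b
    rw [hTT]
    simp [T, Matrix.one_apply]
  · intro γ
    ext a b
    rw [aux_phi_mul, hTm]
    simp only [phi, T, mul_assoc, inv_mul_eq_iff_eq_mul]
  · intro i
    ext a b
    rw [hTT, hTm]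
    simp only [betaTuple, Matrix.diagonal_apply, mul_left_inj, map_mul, Submonoid.coe_mul,
      Matrix.mulVec_mulVec]

lemma aux_star_eig (n : ℕ) (α : Fin n → Matrix Γ Γ ℂ) (hz : ZeroMoment n α) (v : Γ → ℂ)
    (μ : Fin n → ℂ) (h : ∀ i, α i *ᵥ v = μ i • v) (i : Fin n) :
    (α i)ᴴ *ᵥ v = star (μ i) • v := by
  have key : ∀ i, star ((α i)ᴴ *ᵥ v - star (μ i) • v) ⬝ᵥ ((α i)ᴴ *ᵥ v - star (μ i) • v)
      = - (star v ⬝ᵥ (((α i)ᴴ * α i - α i * (α i)ᴴ) *ᵥ v)) := by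
    intro i
    have h1 : star v ⬝ᵥ ((α i)ᴴ *ᵥ v) = star (μ i) * (star v ⬝ᵥ v) := by
      rw [Matrix.dotProduct_mulVec, ← Matrix.star_mulVec, h, star_smul, smul_dotProduct,
        smul_eq_mul]
    have h2 : star ((α i)ᴴ *ᵥ v) = star v ᵥ* α i := by
      rw [Matrix.star_mulVec, Matrix.conjTranspose_conjTranspose]
    rw [Matrix.sub_mulVec, ← Matrix.mulVec_mulVec, ← Matrix.mulVec_mulVec, h, Matrix.mulVec_smul,
      star_sub, star_smul, star_star, h2]
    simp only [sub_dotProduct, dotProduct_sub, smul_dotProduct, dotProduct_smul, smul_eq_mul,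
      ← Matrix.dotProduct_mulVec, h, h1]
    ring
  have hs : ∑ i, star ((α i)ᴴ *ᵥ v - star (μ i) • v) ⬝ᵥ ((α i)ᴴ *ᵥ v - star (μ i) • v) = 0 := by
    simp only [key]
    rw [Finset.sum_neg_distrib, ← dotProduct_sum, ← Matrix.sum_mulVec, hz]
    simp
  rw [Finset.sum_eq_zero_iff_of_nonneg (fun i _ => dotProduct_star_self_nonneg _)] at hs
  have := hs i (Finset.mem_univ i)
  rw [dotProduct_star_self_eq_zero] at this
  exact sub_eq_zero.1 this

lemma aux_orth (n : ℕ) (α : Fin n → Matrix Γ Γ ℂ) (hz : ZeroMoment n α) (v w : Γ → ℂ)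
    (μ ν : Fin n → ℂ) (h : ∀ i, α i *ᵥ v = μ i • v) (h' : ∀ i, α i *ᵥ w = ν i • w)
    (hne : μ ≠ ν) : star v ⬝ᵥ w = 0 := by
  obtain ⟨i, hi⟩ := Function.ne_iff.1 hne
  have h1 : star v ⬝ᵥ (α i *ᵥ w) = ν i * (star v ⬝ᵥ w) := by
    rw [h', dotProduct_smul, smul_eq_mul]
  have h2 : star v ⬝ᵥ (α i *ᵥ w) = μ i * (star v ⬝ᵥ w) := by
    rw [Matrix.dotProduct_mulVec]
    have := Matrix.star_mulVec (α i)ᴴ v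
    rw [Matrix.conjTranspose_conjTranspose] at this
    rw [← this, aux_star_eig n α hz v μ h, star_smul, star_star, smul_dotProduct, smul_eq_mul]
  have h3 : (μ i - ν i) * (star v ⬝ᵥ w) = 0 := by
    rw [sub_mul, ← h1, ← h2, sub_self]
  exact (mul_eq_zero.1 h3).resolve_left (sub_ne_zero.2 hi)

lemma aux_joint (n : ℕ) (α : Fin n → Matrix Γ Γ ℂ) (hc : CommutingTuple n α)
    (W : Submodule ℂ (Γ → ℂ)) (hW : W ≠ ⊥) (hinv : ∀ i, ∀ w ∈ W, α i *ᵥ w ∈ W) :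
    ∃ v ∈ W, v ≠ 0 ∧ ∃ μ : Fin n → ℂ, ∀ i, α i *ᵥ v = μ i • v := by
  have main : ∀ s : Finset (Fin n), ∃ W' : Submodule ℂ (Γ → ℂ), W' ≤ W ∧ W' ≠ ⊥ ∧
      (∀ i, ∀ w ∈ W', α i *ᵥ w ∈ W') ∧
      ∀ i ∈ s, ∃ c : ℂ, ∀ w ∈ W', α i *ᵥ w = c • w := by
    intro s
    induction s using Finset.induction_on with
    | empty => exact ⟨W, le_rfl, hW, hinv, by simp⟩
    | insert i s _ ih =>
      obtain ⟨W', hle, hne, hin, hs⟩ := ih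
      have : Nontrivial W' := Submodule.nontrivial_iff_ne_bot.2 hne
      let f : Module.End ℂ W' := (Matrix.toLin' (α i)).restrict
        (fun w hw => by simpa using hin i w hw)
      obtain ⟨c, hcc⟩ := Module.End.exists_eigenvalue f
      obtain ⟨w, hw⟩ := hcc.exists_hasEigenvector
      have hw1 : α i *ᵥ (w : Γ → ℂ) = c • (w : Γ → ℂ) := by
        have := congrArg Subtype.val hw.apply_eq_smul
        simpa [f] using this
      refine ⟨W' ⊓ Module.End.eigenspace (Matrix.toLin' (α i)) c, inf_le_left.trans hle, ?_, ?_, ?_⟩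
      · intro hb
        have : (w : Γ → ℂ) ∈ W' ⊓ Module.End.eigenspace (Matrix.toLin' (α i)) c :=
          ⟨w.2, by simpa [Module.End.mem_eigenspace_iff] using hw1⟩
        rw [hb, Submodule.mem_bot] at this
        exact hw.2 (Subtype.ext this)
      · rintro j x ⟨hx1, hx2⟩
        refine ⟨hin j x hx1, ?_⟩
        simp only [SetLike.mem_coe, Module.End.mem_eigenspace_iff, Matrix.toLin'_apply] at hx2 ⊢
        rw [Matrix.mulVec_mulVec, hc i j, ← Matrix.mulVec_mulVec, hx2, Matrix.mulVec_smul]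
      · intro j hj
        rcases Finset.mem_insert.1 hj with rfl | hj
        · refine ⟨c, fun x hx => ?_⟩
          have := hx.2
          simpa [Module.End.mem_eigenspace_iff] using this
        · obtain ⟨d, hd⟩ := hs j hj
          exact ⟨d, fun x hx => hd x hx.1⟩
  obtain ⟨W', hle, hne, -, hs⟩ := main Finset.univ
  obtain ⟨v, hv, hv0⟩ := Submodule.exists_mem_ne_zero_of_ne_bot hne
  choose μ hμ using fun i => hs i (Finset.mem_univ i)
  exact ⟨v, hle hv, hv0, μ, fun i => hμ i v hv⟩

lemma aux_zero (n : ℕ) (α : Fin n → Matrix Γ Γ ℂ) (hc : CommutingTuple n α)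
    (hz : ZeroMoment n α)
    (h0 : ∀ (v : Γ → ℂ) (μ : Fin n → ℂ), v ≠ 0 → (∀ i, α i *ᵥ v = μ i • v) → μ = 0) :
    ∀ i, α i = 0 := by
  -- the orthogonal complement of the joint kernel
  let P : Submodule ℂ (Γ → ℂ) :=
    { carrier := {w | ∀ v : Γ → ℂ, (∀ i, α i *ᵥ v = 0) → star v ⬝ᵥ w = 0}
      add_mem' := by
        intro a b ha hb v hv
        rw [dotProduct_add, ha v hv, hb v hv, add_zero]
      zero_mem' := by
        intro v _
        simp
      smul_mem' := by
        intro c a ha v hv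
        rw [dotProduct_smul, ha v hv, smul_zero] }
  have hP : P = ⊥ := by
    by_contra hne
    obtain ⟨v, hvP, hv0, μ, hμ⟩ := aux_joint n α hc P hne (by
      intro i w hw v hv
      rw [Matrix.dotProduct_mulVec]
      have := Matrix.star_mulVec (α i)ᴴ v
      rw [Matrix.conjTranspose_conjTranspose] at this
      rw [← this, aux_star_eig n α hz v 0 (fun i => by simpa using hv i)]
      simp)
    have := h0 v μ hv0 hμ
    subst this
    exact hv0 (dotProduct_star_self_eq_zero.1 (hvP v fun i => by simpa using hμ i))
  -- rows of `α i`, conjugated, lie in `P`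
  intro i
  have hrow : ∀ a, star (α i a) ∈ P := by
    intro a v hv
    have := congrFun (hv i) a
    have h2 : star v ⬝ᵥ star (α i a) = star (α i a ⬝ᵥ v) := star_dotProduct_star _ _
    have h3 : α i a ⬝ᵥ v = 0 := this
    rw [h3, star_zero] at h2
    exact h2
  ext a b
  have := hrow a
  rw [hP, Submodule.mem_bot, star_eq_zero] at this
  exact congrFun this b

lemma aux_surj (n : ℕ) (ρ : Γ →* Matrix.unitaryGroup (Fin n) ℂ) (hfree : FreeOutside n ρ)
    (a : {α : Fin n → Matrix Γ Γ ℂ // IsGood n ρ α}) :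
    ∃ lam, conjRel n ρ ⟨betaTuple n ρ lam, aux_beta_good n ρ lam⟩ a := by
  obtain ⟨α, he, hc, hz⟩ := a
  by_cases h0 : ∀ (v : Γ → ℂ) (μ : Fin n → ℂ), v ≠ 0 → (∀ i, α i *ᵥ v = μ i • v) → μ = 0
  · refine ⟨0, 1, one_mem _, by simp, fun i => ?_⟩
    change α i = 1 * betaTuple n ρ 0 i * 1ᴴ
    rw [aux_zero n α hc hz h0 i]
    simp [betaTuple]
  push Not at h0
  obtain ⟨v₀, μ, hv₀, hev₀, hμ⟩ := h0
  obtain ⟨v, hv1, hev⟩ : ∃ v : Γ → ℂ, star v ⬝ᵥ v = 1 ∧ ∀ i, α i *ᵥ v = μ i • v := by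
    have hpos : 0 < star v₀ ⬝ᵥ v₀ := dotProduct_star_self_pos_iff.2 hv₀
    obtain ⟨hre, him⟩ := Complex.pos_iff.1 hpos
    set x := star v₀ ⬝ᵥ v₀ with hx
    have hxr : x = ((x.re : ℝ) : ℂ) := Complex.ext (by simp) (by simp [← him])
    let c : ℂ := ((Real.sqrt x.re)⁻¹ : ℝ)
    refine ⟨c • v₀, ?_, fun i => ?_⟩
    · rw [star_smul, smul_dotProduct, dotProduct_smul, ← hx, hxr]
      simp only [c, smul_eq_mul, Complex.star_def, Complex.conj_ofReal]
      norm_cast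
      have hs := Real.mul_self_sqrt hre.le
      have hs0 : Real.sqrt x.re ≠ 0 := (Real.sqrt_pos.2 hre).ne'
      field_simp
      nlinarith
    · rw [Matrix.mulVec_smul, hev₀, smul_comm]
  have hφ : ∀ g i, α i *ᵥ (phi g *ᵥ v) =
      ((ρ g : Matrix (Fin n) (Fin n) ℂ) *ᵥ μ) i • (phi g *ᵥ v) := by
    intro g i
    have h1 : α i * phi g = phi g * ∑ l, ((ρ g : Matrix (Fin n) (Fin n) ℂ) i l) • α l := by
      rw [← he g i, ← Matrix.mul_assoc, ← Matrix.mul_assoc, aux_phi_cancel, Matrix.one_mul]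
    rw [Matrix.mulVec_mulVec, h1, ← Matrix.mulVec_mulVec, Matrix.sum_mulVec]
    simp only [Matrix.smul_mulVec, hev, smul_smul]
    rw [← Finset.sum_smul, Matrix.mulVec_smul]
    rfl
  let T : Matrix Γ Γ ℂ := fun a g => v (g⁻¹ * a)
  have hcol : ∀ g, (fun a => T a g) = phi g *ᵥ v := by
    intro g
    ext a
    rw [aux_phi_mulVec]
  have hTT : Tᴴ * T = 1 := by
    ext g d
    have : (Tᴴ * T) g d = star (phi g *ᵥ v) ⬝ᵥ (phi d *ᵥ v) := by
      rw [← hcol, ← hcol]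
      rfl
    rw [this]
    by_cases hgd : g = d
    · subst hgd
      rw [Matrix.one_apply_eq, ← hv1]
      simp only [dotProduct, Pi.star_apply, aux_phi_mulVec]
      exact Equiv.sum_comp (Equiv.mulLeft g⁻¹) (fun a => star (v a) * v a)
    · rw [Matrix.one_apply_ne hgd]
      refine aux_orth n α hz _ _ _ _ (hφ g) (hφ d) fun heq => hgd ?_
      have h2 := congrArg (fun w => (ρ d⁻¹ : Matrix (Fin n) (Fin n) ℂ) *ᵥ w) heq
      simp only [aux_rho_inv] at h2
      rw [Matrix.mulVec_mulVec, ← Submonoid.coe_mul, ← map_mul] at h2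
      exact (inv_mul_eq_one.1 (hfree _ _ hμ h2)).symm
  have hTT' : T * Tᴴ = 1 := mul_eq_one_comm.1 hTT
  refine ⟨μ, T, Matrix.mem_unitaryGroup_iff.2 hTT', ?_, fun i => ?_⟩
  · intro g
    ext a b
    rw [aux_phi_mul, aux_mul_phi]
    simp [T, mul_assoc]
  · have h3 : α i * T = T * betaTuple n ρ μ i := by
      ext a g
      have h4 := congrFun (hφ g i) a
      rw [← hcol] at h4
      rw [betaTuple, Matrix.mul_diagonal, mul_comm]
      exact h4
    change α i = T * betaTuple n ρ μ i * Tᴴ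
    rw [← h3, Matrix.mul_assoc, hTT', Matrix.mul_one]

/-- If `ρ` acts freely outside the origin, then each `β(λ)` is `Γ`-equivariant, commuting and
zero-moment, and `λ ↦ β(λ)` induces a bijection from `ℂⁿ/Γ` onto the set of equivalence
classes of `Γ`-equivariant commuting zero-moment `n`-tuples under simultaneous conjugation
by unitaries commuting with `φ(Γ)`. -/
theorem quotient_equiv_moduli (n : ℕ) (ρ : Γ →* Matrix.unitaryGroup (Fin n) ℂ)
    (hfree : FreeOutside n ρ) :
    ∃ (h : ∀ lam : Fin n → ℂ, IsGood n ρ (betaTuple n ρ lam))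
      (f : Quot (gammaRel n ρ) → Quot (conjRel n ρ)),
      Function.Bijective f ∧
      ∀ lam : Fin n → ℂ,
        f (Quot.mk _ lam) = Quot.mk _ ⟨betaTuple n ρ lam, h lam⟩ := by
  refine ⟨aux_beta_good n ρ, Quot.lift (fun lam => Quot.mk _ ⟨betaTuple n ρ lam, aux_beta_good n ρ lam⟩)
    (fun a b h => Quot.sound (aux_welldef n ρ a b h)), ⟨?_, ?_⟩, fun _ => rfl⟩
  · rintro ⟨lam⟩ ⟨mu⟩ h
    have h1 := congrArg (Quot.lift (fun a : {α : Fin n → Matrix Γ Γ ℂ // IsGood n ρ α} => auxJ n a.1)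
      (auxJ_conj n ρ)) h
    change auxJ n (betaTuple n ρ lam) = auxJ n (betaTuple n ρ mu) at h1
    apply Quot.sound
    rw [← auxJ_beta, h1, auxJ_beta]
    exact ⟨1, by simp⟩
  · rintro ⟨a⟩
    obtain ⟨lam, h⟩ := aux_surj n ρ hfree a
    exact ⟨Quot.mk _ lam, Quot.sound h⟩
end

section
/- For λ ∈ ℂⁿ define the n-tuple β(λ) of endomorphisms of ℂ^Γ by β(λ)_k e_γ := (ρ(γ)λ)_k · e_γ; each β(λ) is Γ-equivariant, commuting, and satisfies the zero-moment condition. The assignment λ ↦ β(λ) induces a well-defined injective map from the orbit space ℂⁿ/Γ into the set of equivalence classes of Γ-equivariant, commuting, zero-moment n-tuples under simultaneous conjugation by unitary operators commuting with φ(Γ); moreover this map is a bijection if and only if ρ acts freely outside the origin. -/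
open Matrix

variable {Γ : Type} [Group Γ] [Fintype Γ] [DecidableEq Γ]

lemma phi_mulVec (γ : Γ) (v : Γ → ℂ) (a : Γ) : (phi γ *ᵥ v) a = v (γ⁻¹ * a) := by
  simp only [Matrix.mulVec, dotProduct, phi]
  rw [Finset.sum_eq_single (γ⁻¹ * a)]
  · simp
  · intro b _ hb
    rw [if_neg, zero_mul]
    rintro rfl
    simp at hb
  · simp

lemma phi_mul_apply (γ : Γ) (M : Matrix Γ Γ ℂ) (a b : Γ) : (phi γ * M) a b = M (γ⁻¹ * a) b := by
  rw [← phi_mulVec γ (fun c => M c b) a]; rfl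

lemma mul_phi_apply (γ : Γ) (M : Matrix Γ Γ ℂ) (a b : Γ) : (M * phi γ) a b = M a (γ * b) := by
  simp [Matrix.mul_apply, phi]

lemma phi_conj_apply (γ : Γ) (M : Matrix Γ Γ ℂ) (a b : Γ) :
    (phi γ⁻¹ * M * phi γ) a b = M (γ * a) (γ * b) := by
  rw [mul_phi_apply, phi_mul_apply, inv_inv]

section
variable {n : ℕ} (ρ : Γ →* Matrix.unitaryGroup (Fin n) ℂ)

lemma rho_mul (γ δ : Γ) (v : Fin n → ℂ) :
    (ρ (γ * δ) : Matrix (Fin n) (Fin n) ℂ) *ᵥ v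
      = (ρ γ : Matrix (Fin n) (Fin n) ℂ) *ᵥ ((ρ δ : Matrix (Fin n) (Fin n) ℂ) *ᵥ v) := by
  rw [map_mul, Matrix.mulVec_mulVec]; rfl

lemma rho_one (v : Fin n → ℂ) : (ρ 1 : Matrix (Fin n) (Fin n) ℂ) *ᵥ v = v := by
  rw [map_one]; simp

lemma rho_inv (γ : Γ) (v w : Fin n → ℂ) (h : w = (ρ γ : Matrix (Fin n) (Fin n) ℂ) *ᵥ v) :
    v = (ρ γ⁻¹ : Matrix (Fin n) (Fin n) ℂ) *ᵥ w := by
  rw [h, ← rho_mul, inv_mul_cancel, rho_one]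

lemma beta_equiv (lam : Fin n → ℂ) : Equivariant n ρ (betaTuple n ρ lam) := by
  intro γ k
  ext a b
  rw [phi_conj_apply]
  simp only [betaTuple, Matrix.sum_apply, Matrix.smul_apply, Matrix.diagonal_apply]
  by_cases h : a = b
  · subst h
    simp only [if_true, smul_eq_mul]
    rw [rho_mul]
    rfl
  · simp [h]

lemma beta_good (lam : Fin n → ℂ) : IsGood n ρ (betaTuple n ρ lam) := by
  refine ⟨beta_equiv ρ lam, ?_, ?_⟩
  · intro i j
    simp [betaTuple, mul_comm]
  · simp [ZeroMoment, betaTuple, Matrix.diagonal_conjTranspose, mul_comm]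

lemma beta_sum (lam : Fin n → ℂ) :
    ∑ i, (betaTuple n ρ lam i)ᴴ * betaTuple n ρ lam i = (star lam ⬝ᵥ lam) • (1 : Matrix Γ Γ ℂ) := by
  have key : ∀ γ : Γ, star ((ρ γ : Matrix (Fin n) (Fin n) ℂ) *ᵥ lam) ⬝ᵥ
      ((ρ γ : Matrix (Fin n) (Fin n) ℂ) *ᵥ lam) = star lam ⬝ᵥ lam := by
    intro γ
    have h : (ρ γ : Matrix (Fin n) (Fin n) ℂ)ᴴ * (ρ γ : Matrix (Fin n) (Fin n) ℂ) = 1 :=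
      (Matrix.mem_unitaryGroup_iff'.1 (ρ γ).2)
    rw [Matrix.star_mulVec, ← Matrix.dotProduct_mulVec, Matrix.mulVec_mulVec, h, Matrix.one_mulVec]
  ext a b
  simp only [betaTuple, Matrix.diagonal_conjTranspose, Matrix.diagonal_mul_diagonal,
    Matrix.sum_apply, Matrix.smul_apply, Matrix.diagonal_apply, Matrix.one_apply]
  by_cases h : a = b
  · subst h
    simp only [if_true, smul_eq_mul, mul_one]
    rw [← key a]; rfl
  · simp [h]

lemma conjRel_equiv : Equivalence (conjRel n ρ) where
  refl a := ⟨1, one_mem _, by simp, by simp⟩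
  symm := by
    rintro a b ⟨T, hT, hc, h⟩
    have h1 : Tᴴ * T = 1 := Matrix.mem_unitaryGroup_iff'.1 hT
    have h2 : T * Tᴴ = 1 := Matrix.mem_unitaryGroup_iff.1 hT
    refine ⟨Tᴴ, Unitary.star_mem hT, ?_, ?_⟩
    · intro γ
      calc Tᴴ * phi γ = Tᴴ * (phi γ * T) * Tᴴ := by
            rw [Matrix.mul_assoc, Matrix.mul_assoc, h2, Matrix.mul_one]
        _ = (Tᴴ * T) * phi γ * Tᴴ := by rw [← hc]; simp only [Matrix.mul_assoc]
        _ = _ := by rw [h1, Matrix.one_mul]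
    · intro i
      rw [h, Matrix.conjTranspose_conjTranspose]
      calc a.1 i = (Tᴴ * T) * a.1 i * (Tᴴ * T) := by rw [h1]; simp
        _ = _ := by simp only [Matrix.mul_assoc]
  trans := by
    rintro a b c ⟨T, hT, hc, h⟩ ⟨S, hS, hc', h'⟩
    refine ⟨S * T, mul_mem hS hT, ?_, ?_⟩
    · intro γ
      rw [Matrix.mul_assoc, hc, ← Matrix.mul_assoc, hc', Matrix.mul_assoc]
    · intro i
      rw [h', h, Matrix.conjTranspose_mul]
      simp only [Matrix.mul_assoc]

lemma conj_exact {a b : {α : Fin n → Matrix Γ Γ ℂ // IsGood n ρ α}}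
    (h : Quot.mk (conjRel n ρ) a = Quot.mk (conjRel n ρ) b) : conjRel n ρ a b :=
  (conjRel_equiv ρ).eqvGen_iff.1 (Quot.eqvGen_exact h)

lemma beta_wd {lam mu : Fin n → ℂ} (h : gammaRel n ρ lam mu) :
    conjRel n ρ ⟨betaTuple n ρ lam, beta_good ρ lam⟩ ⟨betaTuple n ρ mu, beta_good ρ mu⟩ := by
  obtain ⟨γ, rfl⟩ := h
  obtain ⟨T, hT⟩ : ∃ T : Matrix Γ Γ ℂ, ∀ a b, T a b = if a * γ = b then 1 else 0 :=
    ⟨Matrix.of fun a b => if a * γ = b then 1 else 0, fun _ _ => rfl⟩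
  have hH : ∀ a b, Tᴴ a b = if a = b * γ then 1 else 0 := by
    intro a b
    rw [Matrix.conjTranspose_apply, hT]
    by_cases h : a = b * γ
    · simp [h]
    · simp [h, Ne.symm h]
  refine ⟨T, ?_, ?_, ?_⟩
  · rw [Matrix.mem_unitaryGroup_iff, Matrix.star_eq_conjTranspose]
    ext a b
    simp [Matrix.mul_apply, Matrix.one_apply, hT, hH, -Matrix.conjTranspose_apply]
  · intro δ
    ext a b
    rw [mul_phi_apply, phi_mul_apply, hT, hT]
    simp [mul_assoc, inv_mul_eq_iff_eq_mul]
  · intro i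
    change betaTuple n ρ _ i = T * betaTuple n ρ lam i * Tᴴ
    ext a b
    rw [Matrix.mul_apply]
    simp only [betaTuple, Matrix.mul_diagonal, Matrix.diagonal_apply, hT, hH]
    by_cases h : a = b
    · subst h
      rw [Finset.sum_eq_single (a * γ)]
      · simp only [if_true, one_mul, mul_one]
        rw [rho_mul]
      · intro c _ hc
        simp [hc]
      · simp
    · rw [if_neg h, Finset.sum_eq_zero]
      intro c _
      by_cases h1 : a * γ = c
      · subst h1
        simp [h]
      · simp [h1]

lemma beta_inj {lam mu : Fin n → ℂ}
    (h : conjRel n ρ ⟨betaTuple n ρ lam, beta_good ρ lam⟩ ⟨betaTuple n ρ mu, beta_good ρ mu⟩) :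
    gammaRel n ρ lam mu := by
  obtain ⟨T, hT, -, h⟩ := h
  have h1 : Tᴴ * T = 1 := Matrix.mem_unitaryGroup_iff'.1 hT
  have h2 : ∀ i, betaTuple n ρ mu i * T = T * betaTuple n ρ lam i := by
    intro i
    have := h i
    simp only at this
    rw [this, Matrix.mul_assoc, h1, Matrix.mul_one]
  obtain ⟨γ, hγ⟩ : ∃ γ, T γ 1 ≠ 0 := by
    by_contra! hh
    have := congrFun (congrFun h1 1) 1
    simp [Matrix.mul_apply, hh] at this
  refine ⟨γ⁻¹, rho_inv ρ γ _ _ ?_⟩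
  ext k
  have := congrFun (congrFun (h2 k) γ) 1
  simp only [betaTuple, Matrix.mul_diagonal, Matrix.diagonal_mul, rho_one] at this
  rw [mul_comm] at this
  exact (mul_left_cancel₀ hγ this).symm

/-- Non-free case. -/
lemma nonfree {γ₀ : Γ} {v : Fin n → ℂ} (hv : v ≠ 0)
    (hfix : (ρ γ₀ : Matrix (Fin n) (Fin n) ℂ) *ᵥ v = v) (hγ : γ₀ ≠ 1) :
    ∃ a : {α : Fin n → Matrix Γ Γ ℂ // IsGood n ρ α}, ∀ lam,
      ¬ conjRel n ρ ⟨betaTuple n ρ lam, beta_good ρ lam⟩ a := by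
  classical
  obtain ⟨J, hJ⟩ : ∃ J : Matrix Γ Γ ℂ, ∀ a b, J a b = if (ρ a : Matrix (Fin n) (Fin n) ℂ) *ᵥ v
      = (ρ b : Matrix (Fin n) (Fin n) ℂ) *ᵥ v then 1 else 0 :=
    ⟨Matrix.of fun a b => if (ρ a : Matrix (Fin n) (Fin n) ℂ) *ᵥ v
      = (ρ b : Matrix (Fin n) (Fin n) ℂ) *ᵥ v then 1 else 0, fun _ _ => rfl⟩
  have hJH : Jᴴ = J := by
    ext a b
    rw [Matrix.conjTranspose_apply, hJ, hJ]
    by_cases h : (ρ a : Matrix (Fin n) (Fin n) ℂ) *ᵥ v = (ρ b : Matrix (Fin n) (Fin n) ℂ) *ᵥ v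
    · rw [if_pos h, if_pos h.symm, star_one]
    · rw [if_neg h, if_neg (Ne.symm h), star_zero]
  have hcomm : ∀ k, J * betaTuple n ρ v k = betaTuple n ρ v k * J := by
    intro k
    ext a b
    simp only [betaTuple, Matrix.mul_diagonal, Matrix.diagonal_mul, hJ]
    split_ifs with h
    · rw [h]; ring
    · simp
  have hcommH : ∀ k, J * (betaTuple n ρ v k)ᴴ = (betaTuple n ρ v k)ᴴ * J := by
    intro k
    have := congrArg Matrix.conjTranspose (hcomm k)
    rw [Matrix.conjTranspose_mul, Matrix.conjTranspose_mul, hJH] at this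
    exact this.symm
  have hJphi : ∀ γ, J * phi γ = phi γ * J := by
    intro γ
    ext a b
    rw [mul_phi_apply, phi_mul_apply]
    simp only [hJ]
    have : ((ρ a : Matrix (Fin n) (Fin n) ℂ) *ᵥ v = (ρ (γ * b) : Matrix (Fin n) (Fin n) ℂ) *ᵥ v)
      ↔ ((ρ (γ⁻¹ * a) : Matrix (Fin n) (Fin n) ℂ) *ᵥ v
        = (ρ b : Matrix (Fin n) (Fin n) ℂ) *ᵥ v) := by
      constructor
      · intro h; rw [rho_mul, h, ← rho_mul, inv_mul_cancel_left]
      · intro h; rw [rho_mul, ← h, ← rho_mul, mul_inv_cancel_left]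
    simp only [this]
  obtain ⟨he, hc, hz⟩ := beta_good ρ v
  set B := betaTuple n ρ v with hB
  have hgood : IsGood n ρ (fun k => B k * J) := by
    refine ⟨?_, ?_, ?_⟩
    · intro γ k
      have := he γ k
      calc phi γ⁻¹ * (B k * J) * phi γ = phi γ⁻¹ * B k * phi γ * J := by
            simp only [Matrix.mul_assoc, hJphi]
        _ = _ := by rw [this, Finset.sum_mul]; simp
    · intro i j
      calc B i * J * (B j * J) = B i * (J * B j) * J := by simp only [Matrix.mul_assoc]
        _ = (B i * B j) * (J * J) := by rw [hcomm]; simp only [Matrix.mul_assoc]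
        _ = B j * (B i * J) * J := by rw [hc]; simp only [Matrix.mul_assoc]
        _ = _ := by rw [← hcomm]; simp only [Matrix.mul_assoc]
    · have : ∀ i, (B i * J)ᴴ * (B i * J) - (B i * J) * (B i * J)ᴴ
          = ((B i)ᴴ * B i - B i * (B i)ᴴ) * (J * J) := by
        intro i
        rw [Matrix.conjTranspose_mul, hJH, Matrix.sub_mul, hcommH]
        congr 1
        · calc (B i)ᴴ * J * (B i * J) = (B i)ᴴ * (J * B i) * J := by simp only [Matrix.mul_assoc]
            _ = _ := by rw [hcomm]; simp only [Matrix.mul_assoc]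
        · calc B i * J * ((B i)ᴴ * J) = B i * (J * (B i)ᴴ) * J := by simp only [Matrix.mul_assoc]
            _ = _ := by rw [hcommH]; simp only [Matrix.mul_assoc]
      simp only [ZeroMoment, this]
      rw [← Finset.sum_mul]
      simp only [ZeroMoment] at hz
      rw [hz, Matrix.zero_mul]
  refine ⟨⟨_, hgood⟩, ?_⟩
  rintro lam ⟨T, hT, -, h⟩
  have h1 : Tᴴ * T = 1 := Matrix.mem_unitaryGroup_iff'.1 hT
  have h2 : T * Tᴴ = 1 := Matrix.mem_unitaryGroup_iff.1 hT
  simp only at h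
  have e1 : ∑ i, (B i * J)ᴴ * (B i * J) = (star v ⬝ᵥ v) • (J * J) := by
    have : ∀ i, (B i * J)ᴴ * (B i * J) = J * ((B i)ᴴ * B i) * J := by
      intro i
      rw [Matrix.conjTranspose_mul, hJH]; simp only [Matrix.mul_assoc]
    simp only [this]
    rw [← Finset.sum_mul, ← Finset.mul_sum, hB, beta_sum]
    simp
  have e2 : ∑ i, (B i * J)ᴴ * (B i * J) = (star lam ⬝ᵥ lam) • (1 : Matrix Γ Γ ℂ) := by
    have : ∀ i, (B i * J)ᴴ * (B i * J)
        = T * ((betaTuple n ρ lam i)ᴴ * betaTuple n ρ lam i) * Tᴴ := by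
      intro i
      rw [h i]
      simp only [Matrix.conjTranspose_mul, Matrix.conjTranspose_conjTranspose]
      calc _ = T * (betaTuple n ρ lam i)ᴴ * (Tᴴ * T) * betaTuple n ρ lam i * Tᴴ := by
            simp only [Matrix.mul_assoc]
        _ = _ := by rw [h1]; simp only [Matrix.mul_assoc, Matrix.one_mul]
    simp only [this]
    rw [← Finset.sum_mul, ← Finset.mul_sum, beta_sum]
    simp [h2]
  have e3 := congrFun (congrFun (e1.symm.trans e2) γ₀) 1
  simp only [Matrix.smul_apply, Matrix.one_apply, if_neg hγ, smul_eq_mul, mul_zero,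
    mul_eq_zero] at e3
  rcases e3 with e3 | e3
  · open scoped ComplexOrder in
    exact hv (dotProduct_star_self_eq_zero.1 e3)
  · have hmem : (1 : Γ) ∈ Finset.univ.filter (fun c : Γ =>
        (ρ γ₀ : Matrix (Fin n) (Fin n) ℂ) *ᵥ v = (ρ c : Matrix (Fin n) (Fin n) ℂ) *ᵥ v ∧
        (ρ c : Matrix (Fin n) (Fin n) ℂ) *ᵥ v = (ρ 1 : Matrix (Fin n) (Fin n) ℂ) *ᵥ v) := by
      simp only [Finset.mem_filter, Finset.mem_univ, true_and, and_true]
      rw [hfix, rho_one]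
    rw [Matrix.mul_apply] at e3
    simp only [hJ, ite_mul, one_mul, zero_mul, ← ite_and] at e3
    rw [Finset.sum_boole, Nat.cast_eq_zero, Finset.card_eq_zero] at e3
    rw [e3] at hmem
    simp at hmem

end

/-- Joint eigenvectors inside invariant subspaces. -/
lemma joint_eig {ι V : Type*} [AddCommGroup V] [Module ℂ V] [FiniteDimensional ℂ V]
    (f : ι → Module.End ℂ V) (hf : ∀ i j x, f i (f j x) = f j (f i x)) (s : Finset ι) :
    ∀ W : Submodule ℂ V, W ≠ ⊥ → (∀ i, ∀ w ∈ W, f i w ∈ W) →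
      ∃ v ∈ W, v ≠ 0 ∧ ∃ χ : ι → ℂ, ∀ i ∈ s, f i v = χ i • v := by
  classical
  induction s using Finset.induction_on with
  | empty =>
    intro W hW _
    obtain ⟨v, hv, h0⟩ := Submodule.exists_mem_ne_zero_of_ne_bot hW
    exact ⟨v, hv, h0, 0, by simp⟩
  | insert a s ha ih =>
    intro W hW hinv
    haveI : Nontrivial W := Submodule.nontrivial_iff_ne_bot.2 hW
    obtain ⟨μ, hμ⟩ := Module.End.exists_eigenvalue ((f a).restrict (hinv a))
    obtain ⟨w, hw⟩ := hμ.exists_hasEigenvector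
    have hw1 : f a (w : V) = μ • (w : V) := by
      have := congrArg Subtype.val hw.apply_eq_smul
      simpa using this
    have hw0 : (w : V) ≠ 0 := by
      have := hw.2
      simpa using this
    obtain ⟨v, hvW, hv0, χ, hχ⟩ := ih (W ⊓ Module.End.eigenspace (f a) μ)
      (by
        rw [Submodule.ne_bot_iff]
        exact ⟨w, ⟨w.2, Module.End.mem_eigenspace_iff.2 hw1⟩, hw0⟩)
      (by
        rintro i x ⟨hx, hx'⟩
        refine ⟨hinv i x hx, ?_⟩
        rw [SetLike.mem_coe, Module.End.mem_eigenspace_iff] at hx' ⊢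
        rw [hf, hx', map_smul])
    refine ⟨v, hvW.1, hv0, Function.update χ a μ, ?_⟩
    intro i hi
    by_cases hia : i = a
    · subst hia
      simpa using Module.End.mem_eigenspace_iff.1 hvW.2
    · rw [Function.update_of_ne hia]
      exact hχ i (Finset.mem_of_mem_insert_of_ne hi hia)

open scoped ComplexOrder in
/-- Joint eigenvectors of zero-moment tuples are joint eigenvectors of the adjoints. -/
lemma adj_eig {n : ℕ} {α : Fin n → Matrix Γ Γ ℂ} (hz : ZeroMoment n α) {v : Γ → ℂ}
    {χ : Fin n → ℂ} (h : ∀ i, α i *ᵥ v = χ i • v) (i : Fin n) :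
    (α i)ᴴ *ᵥ v = star (χ i) • v := by
  have key : ∀ i, star ((α i)ᴴ *ᵥ v - star (χ i) • v) ⬝ᵥ ((α i)ᴴ *ᵥ v - star (χ i) • v)
      = - (star v ⬝ᵥ (((α i)ᴴ * α i - α i * (α i)ᴴ) *ᵥ v)) := by
    intro i
    have h1 : star v ⬝ᵥ (α i *ᵥ v) = χ i * (star v ⬝ᵥ v) := by
      rw [h]; simp
    have h2 : star v ⬝ᵥ ((α i)ᴴ *ᵥ v) = star (χ i) * (star v ⬝ᵥ v) := by
      rw [Matrix.dotProduct_mulVec, ← Matrix.star_mulVec, h]; simp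
    have h3 : star ((α i)ᴴ *ᵥ v) = star v ᵥ* (α i) := by
      rw [Matrix.star_mulVec, Matrix.conjTranspose_conjTranspose]
    rw [star_sub, h3, Matrix.sub_mulVec, ← Matrix.mulVec_mulVec, ← Matrix.mulVec_mulVec, h i,
      Matrix.mulVec_smul, star_smul, star_star]
    simp only [sub_dotProduct, dotProduct_sub, smul_dotProduct, dotProduct_smul, smul_eq_mul,
      ← Matrix.dotProduct_mulVec, h1, h2]
    ring
  have hsum : ∑ i, star ((α i)ᴴ *ᵥ v - star (χ i) • v) ⬝ᵥ ((α i)ᴴ *ᵥ v - star (χ i) • v) = 0 := by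
    simp only [key]
    rw [Finset.sum_neg_distrib, ← dotProduct_sum, ← Matrix.sum_mulVec, hz]
    simp
  have := (Finset.sum_eq_zero_iff_of_nonneg
    (fun i _ => dotProduct_star_self_nonneg _)).1 hsum i (Finset.mem_univ i)
  exact sub_eq_zero.1 (dotProduct_star_self_eq_zero.1 this)

/-- A nonzero commuting zero-moment tuple has a joint eigenvector with nonzero eigenvalue. -/
lemma exists_nonzero_eig {n : ℕ} {α : Fin n → Matrix Γ Γ ℂ} (hc : CommutingTuple n α)
    (hz : ZeroMoment n α) (h0 : α ≠ 0) :
    ∃ (v : Γ → ℂ) (χ : Fin n → ℂ), v ≠ 0 ∧ χ ≠ 0 ∧ ∀ i, α i *ᵥ v = χ i • v := by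
  by_contra! hcon
  let W : Submodule ℂ (Γ → ℂ) :=
    { carrier := {w | ∀ (v : Γ → ℂ) (χ : Fin n → ℂ), (∀ i, α i *ᵥ v = χ i • v) → star v ⬝ᵥ w = 0}
      add_mem' := by
        intro a b ha hb v χ h
        rw [dotProduct_add, ha v χ h, hb v χ h, add_zero]
      zero_mem' := by intro v χ h; simp
      smul_mem' := by
        intro c a ha v χ h
        rw [dotProduct_smul, ha v χ h, smul_zero] }
  have hadj : ∀ (i : Fin n) (w v : Γ → ℂ) (χ : Fin n → ℂ), (∀ i, α i *ᵥ v = χ i • v) →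
      star v ⬝ᵥ (α i *ᵥ w) = χ i * (star v ⬝ᵥ w) := by
    intro i w v χ h
    have e : star v ᵥ* α i = star ((α i)ᴴ *ᵥ v) := by
      rw [Matrix.star_mulVec, Matrix.conjTranspose_conjTranspose]
    rw [Matrix.dotProduct_mulVec, e, adj_eig hz h]
    simp
  have hW : W = ⊥ := by
    by_contra hW
    obtain ⟨v, hvW, hv0, χ, hχ⟩ := joint_eig (fun i => Matrix.mulVecLin (α i))
      (by intro i j x; simp [Matrix.mulVec_mulVec, hc i j]) Finset.univ W hW
      (by
        intro i w hw v χ h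
        rw [Matrix.mulVecLin_apply, hadj i w v χ h, hw v χ h, mul_zero])
    have := hvW v χ (fun i => hχ i (Finset.mem_univ i))
    open scoped ComplexOrder in
    exact hv0 (dotProduct_star_self_eq_zero.1 this)
  apply h0
  funext i
  have : ∀ w, α i *ᵥ w = 0 := by
    intro w
    have hm : α i *ᵥ w ∈ W := by
      intro v χ h
      rw [hadj i w v χ h]
      by_cases hv : v = 0
      · simp [hv]
      · by_cases hx : χ = 0
        · simp [hx]
        · obtain ⟨j, hj⟩ := hcon v χ hv hx
          exact absurd (h j) hj
    rw [hW] at hm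
    simpa using hm
  ext a b
  have := congrFun (this (Pi.single b 1)) a
  simpa using this

lemma phi_eig {n : ℕ} (ρ : Γ →* Matrix.unitaryGroup (Fin n) ℂ) {α : Fin n → Matrix Γ Γ ℂ}
    (he : Equivariant n ρ α) {v : Γ → ℂ}
    {χ : Fin n → ℂ} (h : ∀ i, α i *ᵥ v = χ i • v) (γ : Γ) (k : Fin n) :
    α k *ᵥ (phi γ *ᵥ v) = ((ρ γ : Matrix (Fin n) (Fin n) ℂ) *ᵥ χ) k • (phi γ *ᵥ v) := by
  have h1 : phi γ * phi γ⁻¹ = (1 : Matrix Γ Γ ℂ) := by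
    ext a b
    rw [phi_mul_apply]
    simp [phi, Matrix.one_apply]
  have h2 : α k * phi γ = phi γ * ∑ l, ((ρ γ : Matrix (Fin n) (Fin n) ℂ) k l) • α l := by
    rw [← he γ k]
    rw [← Matrix.mul_assoc, ← Matrix.mul_assoc, h1, Matrix.one_mul]
  rw [Matrix.mulVec_mulVec, h2, ← Matrix.mulVec_mulVec, Matrix.sum_mulVec]
  simp only [Matrix.smul_mulVec, h, smul_smul]
  rw [← Finset.sum_smul, Matrix.mulVec_smul]
  rfl

lemma free_surj {n : ℕ} (ρ : Γ →* Matrix.unitaryGroup (Fin n) ℂ) (hfree : FreeOutside n ρ)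
    (a : {α : Fin n → Matrix Γ Γ ℂ // IsGood n ρ α}) :
    ∃ lam, conjRel n ρ ⟨betaTuple n ρ lam, beta_good ρ lam⟩ a := by
  obtain ⟨α, hgood⟩ := a
  have ⟨he, hc, hz⟩ := hgood
  by_cases h0 : α = 0
  · refine ⟨0, 1, one_mem _, by simp, ?_⟩
    intro i
    simp [h0, betaTuple]
  obtain ⟨u, χ, hu, hχ, hev⟩ := exists_nonzero_eig hc hz h0
  obtain ⟨v, hv1, hv⟩ : ∃ v : Γ → ℂ, star v ⬝ᵥ v = 1 ∧ ∀ i, α i *ᵥ v = χ i • v := by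
    set c : ℝ := ∑ g, ‖u g‖ ^ 2 with hcdef
    have hc1 : star u ⬝ᵥ u = (c : ℂ) := by
      simp [dotProduct, hcdef, Complex.conj_mul']
    have hc0 : 0 ≤ c := Finset.sum_nonneg (fun _ _ => by positivity)
    have hcne : (c : ℂ) ≠ 0 := by
      rw [← hc1]
      open scoped ComplexOrder in
      exact fun h => hu (dotProduct_star_self_eq_zero.1 h)
    have hs : ((Real.sqrt c : ℝ) : ℂ) * ((Real.sqrt c : ℝ) : ℂ) = c := by
      rw [← Complex.ofReal_mul, Real.mul_self_sqrt hc0]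
    have hsne : ((Real.sqrt c : ℝ) : ℂ) ≠ 0 := by
      intro h; rw [h] at hs; exact hcne (by rw [← hs]; simp)
    refine ⟨((Real.sqrt c : ℝ) : ℂ)⁻¹ • u, ?_, ?_⟩
    · rw [star_smul, smul_dotProduct, dotProduct_smul, hc1, ← hs]
      simp only [star_inv₀, smul_eq_mul, RCLike.star_def, Complex.conj_ofReal]
      field_simp
    · intro i
      rw [Matrix.mulVec_smul, hev, smul_comm]
  set T : Matrix Γ Γ ℂ := fun a γ => v (γ⁻¹ * a) with hT
  have hcol : ∀ γ, (fun a => T a γ) = phi γ *ᵥ v := by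
    intro γ; ext a; rw [phi_mulVec]
  have hunit : Tᴴ * T = 1 := by
    ext γ δ
    have e : (Tᴴ * T) γ δ = star (phi γ *ᵥ v) ⬝ᵥ (phi δ *ᵥ v) := by
      rw [← hcol, ← hcol]; rfl
    by_cases hγδ : γ = δ
    · subst hγδ
      rw [e, Matrix.one_apply_eq, ← hv1]
      simp only [dotProduct, Pi.star_apply, phi_mulVec]
      exact Fintype.sum_equiv (Equiv.mulLeft γ⁻¹) _ _ (fun _ => rfl)
    · rw [e, Matrix.one_apply_ne hγδ]
      by_contra hne
      apply hγδ
      have hval : (ρ γ : Matrix (Fin n) (Fin n) ℂ) *ᵥ χ = (ρ δ : Matrix (Fin n) (Fin n) ℂ) *ᵥ χ := by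
        ext k
        have p1 := phi_eig ρ he hv δ k
        have p2 := adj_eig hz (phi_eig ρ he hv γ) k
        have q : star (phi γ *ᵥ v) ⬝ᵥ (α k *ᵥ (phi δ *ᵥ v))
            = star ((α k)ᴴ *ᵥ (phi γ *ᵥ v)) ⬝ᵥ (phi δ *ᵥ v) := by
          rw [Matrix.star_mulVec (α k)ᴴ, Matrix.conjTranspose_conjTranspose,
            ← Matrix.dotProduct_mulVec]
        rw [p1, p2, star_smul, star_star, smul_dotProduct, dotProduct_smul, smul_eq_mul,
          smul_eq_mul] at q
        exact (mul_right_cancel₀ hne q).symm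
      have := hfree (γ⁻¹ * δ) χ hχ (by
        change (ρ (γ⁻¹ * δ) : Matrix (Fin n) (Fin n) ℂ) *ᵥ χ = χ
        rw [rho_mul, ← hval, ← rho_mul, inv_mul_cancel, rho_one])
      exact inv_mul_eq_one.1 this
  have hunit' : T * Tᴴ = 1 := mul_eq_one_comm.1 hunit
  refine ⟨χ, T, Matrix.mem_unitaryGroup_iff.2 hunit', ?_, ?_⟩
  · intro γ
    ext a b
    rw [mul_phi_apply, phi_mul_apply]
    simp [hT, mul_assoc]
  · intro i
    have : α i * T = T * betaTuple n ρ χ i := by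
      ext a γ
      have p := congrFun (phi_eig ρ he hv γ i) a
      rw [← hcol] at p
      simp only [betaTuple, Matrix.mul_diagonal]
      rw [mul_comm]
      exact p
    change α i = T * betaTuple n ρ χ i * Tᴴ
    rw [← this, Matrix.mul_assoc, hunit', Matrix.mul_one]

/-- Each `β(λ)` is `Γ`-equivariant, commuting and zero-moment, and `λ ↦ β(λ)` induces a
well-defined injective map from `ℂⁿ/Γ` into the set of equivalence classes of
`Γ`-equivariant commuting zero-moment `n`-tuples under simultaneous conjugation by
unitaries commuting with `φ(Γ)`; this map is a bijection if and only if `ρ` acts freely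
outside the origin. -/
theorem injective_and_bijective_iff_free (n : ℕ) (ρ : Γ →* Matrix.unitaryGroup (Fin n) ℂ) :
    ∃ (h : ∀ lam : Fin n → ℂ, IsGood n ρ (betaTuple n ρ lam))
      (f : Quot (gammaRel n ρ) → Quot (conjRel n ρ)),
      (∀ lam : Fin n → ℂ,
        f (Quot.mk _ lam) = Quot.mk _ ⟨betaTuple n ρ lam, h lam⟩) ∧
      Function.Injective f ∧
      (Function.Bijective f ↔ FreeOutside n ρ) := by
  refine ⟨beta_good ρ, Quot.lift (fun lam => Quot.mk _ ⟨betaTuple n ρ lam, beta_good ρ lam⟩)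
    (fun _ _ h => Quot.sound (beta_wd ρ h)), fun _ => rfl, ?_, ?_⟩
  · rintro ⟨lam⟩ ⟨mu⟩ h
    exact Quot.sound (beta_inj ρ (conj_exact ρ h))
  · constructor
    · intro hb γ v hv hfix
      by_contra hγ
      obtain ⟨a, ha⟩ := nonfree ρ hv hfix hγ
      obtain ⟨⟨lam⟩, hq⟩ := hb.2 (Quot.mk _ a)
      exact ha lam (conj_exact ρ hq)
    · intro hfree
      refine ⟨?_, ?_⟩
      · rintro ⟨lam⟩ ⟨mu⟩ h
        exact Quot.sound (beta_inj ρ (conj_exact ρ h))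
      · rintro ⟨a⟩
        obtain ⟨lam, h⟩ := free_surj ρ hfree a
        exact ⟨Quot.mk _ lam, Quot.sound h⟩
end
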